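/- For every real t and every θ ∈ (0,π): Σ_{m≥1} (−1)^m J_m(2t) cos(mθ) = (cos(2t·sinθ) − J₀(2t))/2 − (1/(2π)) · p.v.∫₀^π sin(2t·sinφ)·sinφ/(cosθ − cosφ) dφ, where the principal value integral is the limit as ε → 0⁺ of the integral over [0,π] ∖ (θ−ε, θ+ε). -/

import Mathlib

open MeasureTheory Filter

/-- Bessel function of the first kind of integer order `n` (real variable):
`J_n(x) = Σ_{p≥0} (-1)^p/(p!(n+p)!) (x/2)^{n+2p}`. -/
noncomputable def besselJR (n : ℕ) (x : ℝ) : ℝ :=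
  ∑' p : ℕ, ((-1) ^ p / ((Nat.factorial p : ℝ) * (Nat.factorial (n + p) : ℝ))) *
    (x / 2) ^ (n + 2 * p)

noncomputable def Qf (θ : ℝ) : ℕ → ℝ → ℝ
  | 0, _ => 0
  | 1, φ => Real.cos θ + Real.cos φ
  | (n+2), φ => 2 * Real.cos θ * Qf θ (n+1) φ - 2 * (Real.sin ((n+1 : ℝ) * φ) * Real.sin φ) - Qf θ n φ

lemma sin_rec (n : ℕ) (φ : ℝ) : Real.sin (((n+2 : ℕ) : ℝ) * φ) =
    2 * Real.cos φ * Real.sin (((n+1:ℕ):ℝ) * φ) - Real.sin ((n:ℝ) * φ) := by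
  have e1 : (((n+2 : ℕ) : ℝ) * φ) = (n+1:ℝ)*φ + φ := by push_cast; ring
  have e2 : ((n : ℝ) * φ) = (n+1:ℝ)*φ - φ := by ring
  rw [e1, e2, Real.sin_add, Real.sin_sub]; push_cast; ring

lemma cos_rec (n : ℕ) (φ : ℝ) : Real.cos (((n+2 : ℕ) : ℝ) * φ) =
    2 * Real.cos φ * Real.cos (((n+1:ℕ):ℝ) * φ) - Real.cos ((n:ℝ) * φ) := by
  have e1 : (((n+2 : ℕ) : ℝ) * φ) = (n+1:ℝ)*φ + φ := by push_cast; ring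
  have e2 : ((n : ℝ) * φ) = (n+1:ℝ)*φ - φ := by ring
  rw [e1, e2, Real.cos_add, Real.cos_sub]; push_cast; ring

lemma Qf_spec (θ φ : ℝ) (n : ℕ) : Qf θ n φ * (Real.cos θ - Real.cos φ) =
    Real.sin (n * φ) * Real.sin φ - Real.sin (n * θ) * Real.sin θ := by
  induction n using Nat.twoStepInduction with
  | zero => simp [Qf]
  | one =>
    simp only [Qf, Nat.cast_one, one_mul]
    nlinarith [Real.sin_sq_add_cos_sq θ, Real.sin_sq_add_cos_sq φ]
  | more n h0 h1 =>
    rw [sin_rec, sin_rec]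
    simp only [Qf]
    push_cast at h0 h1 ⊢
    linear_combination 2 * Real.cos θ * h1 - h0

lemma Qf_cont (θ : ℝ) (n : ℕ) : Continuous (Qf θ n) := by
  induction n using Nat.twoStepInduction with
  | zero => exact continuous_const
  | one => change Continuous (fun φ => Real.cos θ + Real.cos φ); fun_prop
  | more n h0 h1 =>
    change Continuous (fun φ => 2 * Real.cos θ * Qf θ (n+1) φ - 2 * (Real.sin ((n+1 : ℝ) * φ) * Real.sin φ) - Qf θ n φ)
    fun_prop

lemma Qf_bound (θ φ : ℝ) (n : ℕ) : |Qf θ n φ| ≤ 4 ^ n := by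
  induction n using Nat.twoStepInduction with
  | zero => simp [Qf]
  | one =>
    simp only [Qf]
    have := Real.neg_one_le_cos θ
    have := Real.neg_one_le_cos φ
    have := Real.cos_le_one θ
    have := Real.cos_le_one φ
    rw [abs_le]; constructor <;> linarith
  | more n h0 h1 =>
    simp only [Qf]
    have a1 : |2 * Real.cos θ * Qf θ (n+1) φ| ≤ 2 * 4 ^ (n+1) := by
      rw [abs_mul, abs_mul, abs_two]
      have := Real.abs_cos_le_one θ
      have h := mul_le_mul this h1 (abs_nonneg _) zero_le_one
      linarith
    have a2 : |2 * (Real.sin ((n+1 : ℝ) * φ) * Real.sin φ)| ≤ 2 := by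
      rw [abs_mul, abs_mul, abs_two]
      have h := mul_le_mul (Real.abs_sin_le_one ((n+1 : ℝ) * φ)) (Real.abs_sin_le_one φ) (abs_nonneg _) zero_le_one
      linarith
    have h4 : (1:ℝ) ≤ 4 ^ n := one_le_pow₀ (by norm_num)
    have e1 := abs_sub (2 * Real.cos θ * Qf θ (n+1) φ - 2 * (Real.sin ((n+1 : ℝ) * φ) * Real.sin φ)) (Qf θ n φ)
    have e2 := abs_sub (2 * Real.cos θ * Qf θ (n+1) φ) (2 * (Real.sin ((n+1 : ℝ) * φ) * Real.sin φ))
    rw [pow_succ] at a1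
    rw [pow_succ, pow_succ]
    linarith

lemma int_cos_nat (k : ℕ) (hk : k ≠ 0) : ∫ φ in (0:ℝ)..Real.pi, Real.cos (k * φ) = 0 := by
  have hk' : (k:ℝ) ≠ 0 := by exact_mod_cast hk
  rw [intervalIntegral.integral_comp_mul_left (f := Real.cos) hk', integral_cos]
  simp

lemma int_ss (n : ℕ) : ∫ φ in (0:ℝ)..Real.pi, Real.sin ((n+1 : ℝ) * φ) * Real.sin φ =
    if n = 0 then Real.pi / 2 else 0 := by
  have e : ∀ φ : ℝ, Real.sin ((n+1 : ℝ) * φ) * Real.sin φ =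
      (Real.cos ((n:ℝ) * φ) - Real.cos (((n+2:ℕ):ℝ) * φ)) / 2 := by
    intro φ
    have e1 : (((n+2 : ℕ) : ℝ) * φ) = (n+1:ℝ)*φ + φ := by push_cast; ring
    have e2 : ((n : ℝ) * φ) = (n+1:ℝ)*φ - φ := by ring
    rw [e1, e2, Real.cos_add, Real.cos_sub]; ring
  simp_rw [e]
  rw [intervalIntegral.integral_div, intervalIntegral.integral_sub
    (by apply Continuous.intervalIntegrable; fun_prop) (by apply Continuous.intervalIntegrable; fun_prop),
    int_cos_nat (n+2) (by omega)]
  split_ifs with h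
  · subst h; simp
  · rw [int_cos_nat n h]; simp

lemma Qf_int (θ : ℝ) (n : ℕ) : ∫ φ in (0:ℝ)..Real.pi, Qf θ (n+1) φ = Real.pi * Real.cos ((n+1:ℕ) * θ) := by
  have key : ∀ n, ∫ φ in (0:ℝ)..Real.pi, Qf θ (n+2) φ =
      2 * Real.cos θ * (∫ φ in (0:ℝ)..Real.pi, Qf θ (n+1) φ) - 2 * (if n = 0 then Real.pi / 2 else 0)
        - ∫ φ in (0:ℝ)..Real.pi, Qf θ n φ := by
    intro n
    have c0 := Qf_cont θ n
    have c1 := Qf_cont θ (n+1)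
    simp only [Qf]
    rw [intervalIntegral.integral_sub
      (by apply Continuous.intervalIntegrable; fun_prop) (by apply Continuous.intervalIntegrable; fun_prop),
      intervalIntegral.integral_sub
      (by apply Continuous.intervalIntegrable; fun_prop) (by apply Continuous.intervalIntegrable; fun_prop),
      intervalIntegral.integral_const_mul, intervalIntegral.integral_const_mul, int_ss]
  have b1 : ∫ φ in (0:ℝ)..Real.pi, Qf θ 1 φ = Real.pi * Real.cos θ := by
    simp only [Qf]
    rw [intervalIntegral.integral_add
      (by apply Continuous.intervalIntegrable; fun_prop) (by apply Continuous.intervalIntegrable; fun_prop)]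
    simp
  induction n using Nat.twoStepInduction with
  | zero => simpa using b1
  | one =>
    rw [key 0, b1]
    simp only [Qf, Nat.reduceAdd, Nat.cast_ofNat, Real.cos_two_mul]
    simp; ring
  | more n h0 h1 =>
    rw [key (n+1), h1, h0, cos_rec (n+1)]
    simp; ring

lemma bes_term_bound (n : ℕ) (t : ℝ) (p : ℕ) :
    ‖((-1) ^ p / ((Nat.factorial p : ℝ) * (Nat.factorial (n + p) : ℝ))) * (2 * t / 2) ^ (n + 2 * p)‖
      ≤ |t| ^ n / (Nat.factorial n : ℝ) * ((t^2) ^ p / (Nat.factorial p : ℝ)) := by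
  have e : 2 * t / 2 = t := by ring
  rw [e, norm_mul, norm_div, norm_pow, norm_pow, norm_neg, norm_one, one_pow, Real.norm_eq_abs,
    Real.norm_eq_abs, abs_of_nonneg (by positivity : (0:ℝ) ≤ (Nat.factorial p : ℝ) * (Nat.factorial (n + p) : ℝ)),
    pow_add, pow_mul, sq_abs]
  have h : (Nat.factorial n : ℝ) ≤ (Nat.factorial (n+p) : ℝ) := by
    exact_mod_cast Nat.factorial_le (by omega)
  have hn : (0:ℝ) < Nat.factorial n := by exact_mod_cast Nat.factorial_pos n
  have hp : (0:ℝ) < Nat.factorial p := by exact_mod_cast Nat.factorial_pos p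
  calc 1 / ((Nat.factorial p : ℝ) * (Nat.factorial (n + p) : ℝ)) * (|t| ^ n * (t ^ 2) ^ p)
      ≤ 1 / ((Nat.factorial p : ℝ) * (Nat.factorial n : ℝ)) * (|t| ^ n * (t ^ 2) ^ p) := by gcongr
    _ = _ := by field_simp

lemma bes_summable (n : ℕ) (t : ℝ) : Summable (fun p : ℕ =>
    ((-1) ^ p / ((Nat.factorial p : ℝ) * (Nat.factorial (n + p) : ℝ))) * (2 * t / 2) ^ (n + 2 * p)) :=
  Summable.of_norm_bounded ((Real.summable_pow_div_factorial (t^2)).mul_left _) (bes_term_bound n t)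

lemma bes_hasSum (n : ℕ) (t : ℝ) : HasSum (fun p : ℕ =>
    ((-1) ^ p / ((Nat.factorial p : ℝ) * (Nat.factorial (n + p) : ℝ))) * (2 * t / 2) ^ (n + 2 * p))
    (besselJR n (2 * t)) := (bes_summable n t).hasSum

lemma bes_bound (t : ℝ) : ∃ C : ℝ, 0 ≤ C ∧ ∀ n, |besselJR n (2 * t)| ≤ C * (|t| ^ n / (Nat.factorial n : ℝ)) := by
  refine ⟨∑' p : ℕ, (t^2) ^ p / (Nat.factorial p : ℝ), tsum_nonneg (fun p => by positivity), fun n => ?_⟩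
  have h := tsum_of_norm_bounded ((Real.summable_pow_div_factorial (t^2)).hasSum.mul_left _) (bes_term_bound n t)
  rw [mul_comm (tsum _)]
  exact h

def zEquiv : ℤ × ℕ ≃ ℕ × ℕ where
  toFun x := (x.2 + x.1.toNat, x.2 + (-x.1).toNat)
  invFun y := ((y.1 : ℤ) - y.2, min y.1 y.2)
  left_inv x := by
    obtain ⟨a, b⟩ := x
    ext <;> simp <;> omega
  right_inv y := by
    obtain ⟨a, b⟩ := y
    ext <;> simp <;> omega

lemma term_eq (t : ℝ) (w : ℂ) (hw : w ≠ 0) (n : ℤ) (p : ℕ) :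
    (t * w) ^ (p + n.toNat) / (Nat.factorial (p + n.toNat) : ℂ) *
      ((-t * w⁻¹) ^ (p + (-n).toNat) / (Nat.factorial (p + (-n).toNat) : ℂ)) =
    (((((-1) ^ p / ((Nat.factorial p : ℝ) * (Nat.factorial (n.natAbs + p) : ℝ))) * (2 * t / 2) ^ (n.natAbs + 2 * p) : ℝ)) : ℂ)
      * (-1) ^ (-n).toNat * w ^ n := by
  have e : 2 * t / 2 = t := by ring
  have hf : ∀ k : ℕ, (Nat.factorial k : ℂ) ≠ 0 := fun k => by exact_mod_cast Nat.factorial_ne_zero k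
  rw [e]
  obtain ⟨m, rfl | rfl⟩ := n.eq_nat_or_neg
  · have i1 : ((m:ℤ)).toNat = m := by simp
    have i2 : (-(m:ℤ)).toNat = 0 := by simp
    rw [i1, i2, Int.natAbs_natCast, add_comm p m, zpow_natCast]
    push_cast
    simp only [add_zero]
    have := hf p
    have := hf (m+p)
    rw [mul_pow, mul_pow, neg_pow (t:ℂ), inv_pow]
    field_simp
    ring
  · have i1 : (-(m:ℤ)).toNat = 0 := by simp
    have i2 : (-(-(m:ℤ))).toNat = m := by simp
    rw [i1, i2, Int.natAbs_neg, Int.natAbs_natCast, add_comm p m, zpow_neg, zpow_natCast]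
    push_cast
    simp only [add_zero]
    have := hf p
    have := hf (m+p)
    rw [mul_pow, mul_pow, neg_pow (t:ℂ), inv_pow]
    field_simp
    ring

lemma exp_hs (z : ℂ) : HasSum (fun n : ℕ => z ^ n / (Nat.factorial n : ℂ)) (Complex.exp z) := by
  rw [Complex.exp_eq_exp_ℂ]; exact NormedSpace.expSeries_div_hasSum_exp z

lemma exp_sn (y : ℂ) : Summable (fun n : ℕ => ‖y ^ n / (Nat.factorial n : ℂ)‖) := by
  have h := Real.summable_pow_div_factorial ‖y‖
  have e : (fun n : ℕ => ‖y ^ n / (Nat.factorial n : ℂ)‖) = fun n : ℕ => ‖y‖ ^ n / (Nat.factorial n : ℝ) := by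
    funext n
    rw [norm_div, norm_pow, Complex.norm_natCast]
  rw [e]
  exact h

lemma exp_sm (y z : ℂ) : Summable (fun x : ℕ × ℕ =>
    (y ^ x.1 / (Nat.factorial x.1 : ℂ)) * (z ^ x.2 / (Nat.factorial x.2 : ℂ))) := by
  exact summable_mul_of_summable_norm (f := fun n : ℕ => y ^ n / (Nat.factorial n : ℂ))
    (g := fun n : ℕ => z ^ n / (Nat.factorial n : ℂ)) (exp_sn y) (exp_sn z)

lemma exp_gen (t : ℝ) (w : ℂ) (hw : w ≠ 0) :
    HasSum (fun n : ℤ => (besselJR n.natAbs (2 * t) : ℂ) * (-1) ^ (-n).toNat * w ^ n)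
      (Complex.exp (t * w) * Complex.exp (- t * w⁻¹)) := by
  have h1 := exp_hs (t * w)
  have h2 := exp_hs (-t * w⁻¹)
  have h3 := h1.mul h2 (exp_sm (t * w) (-t * w⁻¹))
  have h4 := (zEquiv.hasSum_iff).2 h3
  refine h4.prod_fiberwise fun n => ?_
  have hb2 := ((Complex.hasSum_ofReal.2 (bes_hasSum n.natAbs t)).mul_right ((-1) ^ (-n).toNat)).mul_right (w ^ n)
  have hfe := funext (term_eq t w hw n)
  rw [← hfe] at hb2
  exact hb2

lemma gen2 (t φ : ℝ) :
    HasSum (fun n : ℕ => (besselJR n (2 * t) : ℂ) * 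
      (Complex.exp (n * φ * Complex.I) + (-1) ^ n * Complex.exp (-(n * φ * Complex.I))))
      (Complex.exp ((2 * t * Real.sin φ : ℝ) * Complex.I) + besselJR 0 (2 * t)) := by
  have h := (exp_gen t (Complex.exp (φ * Complex.I)) (Complex.exp_ne_zero _)).nat_add_neg
  convert h using 1
  · ext n
    have : Complex.exp (n * φ * Complex.I) = Complex.exp (φ * Complex.I) ^ n := by
      rw [← Complex.exp_nat_mul]; ring_nf
    simp [Complex.exp_neg, this]
    ring
  · rw [← Complex.exp_add, ← Complex.exp_neg]
    simp
    congr 1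
    rw [Complex.sin]
    ring_nf
    simp

lemma even_sum (t φ : ℝ) :
    HasSum (fun n : ℕ => (1 + (-1) ^ n) * besselJR n (2 * t) * Real.cos (n * φ))
      (Real.cos (2 * t * Real.sin φ) + besselJR 0 (2 * t)) := by
  have h := Complex.hasSum_re (gen2 t φ)
  convert h using 1
  · ext n
    have e1 : (n * φ * Complex.I : ℂ) = ((n * φ : ℝ) : ℂ) * Complex.I := by push_cast; ring
    have e2 : -(n * φ * Complex.I : ℂ) = ((-(n * φ) : ℝ) : ℂ) * Complex.I := by push_cast; ring
    have e3 : ((-1 : ℂ)) ^ n = (((-1 : ℝ) ^ n : ℝ) : ℂ) := by push_cast; rfl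
    rw [e2, e1, e3, Complex.re_ofReal_mul, Complex.add_re, Complex.re_ofReal_mul,
      Complex.exp_ofReal_mul_I_re, Complex.exp_ofReal_mul_I_re, Real.cos_neg]
    ring
  · rw [Complex.add_re, Complex.exp_ofReal_mul_I_re, Complex.ofReal_re]

lemma odd_sum (t φ : ℝ) :
    HasSum (fun n : ℕ => (1 - (-1) ^ n) * besselJR n (2 * t) * Real.sin (n * φ))
      (Real.sin (2 * t * Real.sin φ)) := by
  have h := Complex.hasSum_im (gen2 t φ)
  convert h using 1
  · ext n
    have e1 : (n * φ * Complex.I : ℂ) = ((n * φ : ℝ) : ℂ) * Complex.I := by push_cast; ring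
    have e2 : -(n * φ * Complex.I : ℂ) = ((-(n * φ) : ℝ) : ℂ) * Complex.I := by push_cast; ring
    have e3 : ((-1 : ℂ)) ^ n = (((-1 : ℝ) ^ n : ℝ) : ℂ) := by push_cast; rfl
    rw [e2, e1, e3, Complex.im_ofReal_mul, Complex.add_im, Complex.im_ofReal_mul,
      Complex.exp_ofReal_mul_I_im, Complex.exp_ofReal_mul_I_im, Real.sin_neg]
    ring
  · rw [Complex.add_im, Complex.exp_ofReal_mul_I_im, Complex.ofReal_im, add_zero]

noncomputable def Af (θ φ : ℝ) : ℝ :=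
  (Real.log (Real.sin ((φ - θ) / 2)) - Real.log (Real.sin ((φ + θ) / 2))) / Real.sin θ

lemma cos_ne {θ φ : ℝ} (hθ : θ ∈ Set.Ioo 0 Real.pi) (hφ : φ ∈ Set.Icc 0 Real.pi) (h : φ ≠ θ) :
    Real.cos θ - Real.cos φ ≠ 0 := by
  intro h0
  exact h (Real.injOn_cos hφ ⟨hθ.1.le, hθ.2.le⟩ (by linarith))

lemma Af_deriv {θ φ : ℝ} (hθ : θ ∈ Set.Ioo 0 Real.pi) (hφ : φ ∈ Set.Icc 0 Real.pi) (h : φ ≠ θ) :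
    HasDerivAt (Af θ) (1 / (Real.cos θ - Real.cos φ)) φ := by
  have hc := cos_ne hθ hφ h
  have hs : Real.sin θ ≠ 0 := (Real.sin_pos_of_mem_Ioo hθ).ne'
  have e : Real.cos θ - Real.cos φ = 2 * Real.sin ((φ + θ) / 2) * Real.sin ((φ - θ) / 2) := by
    rw [Real.cos_sub_cos, add_comm θ φ, ← neg_sub φ θ, neg_div, Real.sin_neg]; ring
  have h1 : Real.sin ((φ + θ) / 2) ≠ 0 := by intro h1; rw [e, h1] at hc; simp at hc
  have h2 : Real.sin ((φ - θ) / 2) ≠ 0 := by intro h1; rw [e, h1] at hc; simp at hc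
  have d1 : HasDerivAt (fun φ : ℝ => Real.sin ((φ - θ) / 2)) (Real.cos ((φ - θ) / 2) * (1 / 2)) φ :=
    (((hasDerivAt_id φ).sub_const θ).div_const 2).sin
  have d2 : HasDerivAt (fun φ : ℝ => Real.sin ((φ + θ) / 2)) (Real.cos ((φ + θ) / 2) * (1 / 2)) φ :=
    (((hasDerivAt_id φ).add_const θ).div_const 2).sin
  have d := ((d1.log h2).sub (d2.log h1)).div_const (Real.sin θ)
  refine d.congr_deriv ?_
  have e2 : Real.sin θ = Real.sin ((φ + θ) / 2) * Real.cos ((φ - θ) / 2) -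
      Real.cos ((φ + θ) / 2) * Real.sin ((φ - θ) / 2) := by
    rw [← Real.sin_sub]; congr 1; ring
  rw [e]
  field_simp
  rw [e2]; ring

lemma Af_zero (θ : ℝ) : Af θ 0 = 0 := by
  unfold Af
  rw [zero_sub, neg_div, Real.sin_neg, Real.log_neg_eq_log, zero_add, sub_self, zero_div]

lemma Af_pi (θ : ℝ) : Af θ Real.pi = 0 := by
  unfold Af
  have : Real.sin ((Real.pi - θ) / 2) = Real.sin ((Real.pi + θ) / 2) := by
    rw [← Real.sin_pi_sub]; congr 1; ring
  rw [this, sub_self, zero_div]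

lemma Af_lim {θ : ℝ} (hθ : θ ∈ Set.Ioo 0 Real.pi) :
    Tendsto (fun ε => Af θ (θ - ε) - Af θ (θ + ε)) (nhdsWithin 0 (Set.Ioi 0)) (nhds 0) := by
  have hs : Real.sin θ ≠ 0 := (Real.sin_pos_of_mem_Ioo hθ).ne'
  have e : (fun ε => Af θ (θ - ε) - Af θ (θ + ε)) = fun ε =>
      (Real.log (Real.sin (θ + ε / 2)) - Real.log (Real.sin (θ - ε / 2))) / Real.sin θ := by
    ext ε
    unfold Af
    have a1 : (θ - ε - θ) / 2 = -(ε / 2) := by ring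
    have a2 : (θ + ε - θ) / 2 = ε / 2 := by ring
    have a3 : (θ - ε + θ) / 2 = θ - ε / 2 := by ring
    have a4 : (θ + ε + θ) / 2 = θ + ε / 2 := by ring
    rw [a1, a2, a3, a4, Real.sin_neg, Real.log_neg_eq_log]; ring
  rw [e]
  have : ContinuousAt (fun ε => (Real.log (Real.sin (θ + ε / 2)) - Real.log (Real.sin (θ - ε / 2))) / Real.sin θ) 0 := by
    refine ContinuousAt.div_const (ContinuousAt.sub ?_ ?_) _
    · exact ContinuousAt.log (by fun_prop) (by simpa using hs)
    · exact ContinuousAt.log (by fun_prop) (by simpa using hs)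
  have h := this.tendsto
  simp only [zero_div, add_zero, sub_zero, sub_self] at h
  exact h.mono_left nhdsWithin_le_nhds

lemma pv_lim {θ : ℝ} (hθ : θ ∈ Set.Ioo 0 Real.pi) (g Q : ℝ → ℝ) (c : ℝ) (hQ : Continuous Q)
    (hg : ∀ φ, Q φ * (Real.cos θ - Real.cos φ) = g φ - c) :
    Tendsto (fun ε : ℝ => ∫ φ in Set.Icc 0 Real.pi \ Set.Ioo (θ - ε) (θ + ε), g φ / (Real.cos θ - Real.cos φ))
      (nhdsWithin 0 (Set.Ioi 0)) (nhds (∫ φ in (0:ℝ)..Real.pi, Q φ)) := by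
  have piece : ∀ a b, a ≤ b → Set.Icc a b ⊆ Set.Icc 0 Real.pi \ {θ} →
      IntegrableOn (fun φ => g φ / (Real.cos θ - Real.cos φ)) (Set.Icc a b) ∧
      ∫ φ in Set.Icc a b, g φ / (Real.cos θ - Real.cos φ) =
        (∫ φ in a..b, Q φ) + c * (Af θ b - Af θ a) := by
    intro a b hab hsub
    have hne : ∀ φ ∈ Set.Icc a b, Real.cos θ - Real.cos φ ≠ 0 := fun φ hφ =>
      cos_ne hθ (hsub hφ).1 (hsub hφ).2
    have hcont : ContinuousOn (fun φ => 1 / (Real.cos θ - Real.cos φ)) (Set.Icc a b) :=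
      ContinuousOn.div continuousOn_const (by fun_prop) hne
    have heq : Set.EqOn (fun φ => g φ / (Real.cos θ - Real.cos φ))
        (fun φ => Q φ + c * (1 / (Real.cos θ - Real.cos φ))) (Set.Icc a b) := by
      intro φ hφ
      have h1 := hne φ hφ
      have h2 := hg φ
      simp only
      field_simp
      linarith
    have hcont2 : ContinuousOn (fun φ => Q φ + c * (1 / (Real.cos θ - Real.cos φ))) (Set.Icc a b) :=
      hQ.continuousOn.add (continuousOn_const.mul hcont)
    refine ⟨(hcont2.congr heq).integrableOn_Icc, ?_⟩
    rw [setIntegral_congr_fun measurableSet_Icc heq, integral_Icc_eq_integral_Ioc,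
      ← intervalIntegral.integral_of_le hab]
    have hu : Set.uIcc a b = Set.Icc a b := Set.uIcc_of_le hab
    have hii : IntervalIntegrable (fun φ => 1 / (Real.cos θ - Real.cos φ)) volume a b :=
      ContinuousOn.intervalIntegrable (by rwa [hu])
    rw [intervalIntegral.integral_add (hQ.intervalIntegrable _ _) (hii.const_mul c),
      intervalIntegral.integral_const_mul, intervalIntegral.integral_eq_sub_of_hasDerivAt _ hii]
    intro φ hφ
    rw [hu] at hφ
    exact Af_deriv hθ (hsub hφ).1 (hsub hφ).2
  have hev : ∀ᶠ ε in nhdsWithin (0:ℝ) (Set.Ioi 0),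
      ((∫ φ in (0:ℝ)..(θ - ε), Q φ) + ((∫ φ in (0:ℝ)..Real.pi, Q φ) - ∫ φ in (0:ℝ)..(θ + ε), Q φ)) +
        c * (Af θ (θ - ε) - Af θ (θ + ε)) =
      ∫ φ in Set.Icc 0 Real.pi \ Set.Ioo (θ - ε) (θ + ε), g φ / (Real.cos θ - Real.cos φ) := by
    have hpos : 0 < min θ (Real.pi - θ) := lt_min hθ.1 (by linarith [hθ.2])
    filter_upwards [Ioo_mem_nhdsGT hpos] with ε hε
    have h0 := hε.1
    have h1 := lt_of_lt_of_le hε.2 (min_le_left _ _)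
    have h2 := lt_of_lt_of_le hε.2 (min_le_right _ _)
    have hset : Set.Icc 0 Real.pi \ Set.Ioo (θ - ε) (θ + ε) = Set.Icc 0 (θ - ε) ∪ Set.Icc (θ + ε) Real.pi := by
      ext x
      simp only [Set.mem_sdiff, Set.mem_Icc, Set.mem_Ioo, Set.mem_union, not_and, not_lt]
      constructor
      · rintro ⟨⟨a, b⟩, h⟩
        rcases lt_or_ge (θ - ε) x with h' | h'
        · exact Or.inr ⟨h h', b⟩
        · exact Or.inl ⟨a, h'⟩
      · rintro (⟨a, b⟩ | ⟨a, b⟩)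
        · exact ⟨⟨a, by linarith⟩, fun h => by linarith⟩
        · exact ⟨⟨by linarith, b⟩, fun h => a⟩
    have p1 := piece 0 (θ - ε) (by linarith) (by
      rintro x ⟨a, b⟩
      exact ⟨⟨a, by linarith⟩, fun h => by rw [Set.mem_singleton_iff] at h; linarith⟩)
    have p2 := piece (θ + ε) Real.pi (by linarith) (by
      rintro x ⟨a, b⟩
      exact ⟨⟨by linarith [hθ.1], b⟩, fun h => by rw [Set.mem_singleton_iff] at h; linarith⟩)
    rw [hset, setIntegral_union _ measurableSet_Icc p1.1 p2.1, p1.2, p2.2, Af_zero, Af_pi,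
      intervalIntegral.integral_interval_sub_left (hQ.intervalIntegrable _ _) (hQ.intervalIntegrable _ _)]
    · ring
    · rw [Set.disjoint_left]
      rintro x ⟨_, b⟩ ⟨c, _⟩
      linarith
  refine Tendsto.congr' hev ?_
  have hP : Continuous (fun x => ∫ φ in (0:ℝ)..x, Q φ) :=
    intervalIntegral.continuous_primitive (fun a b => hQ.intervalIntegrable _ _) 0
  have hc : Continuous (fun ε => (∫ φ in (0:ℝ)..(θ - ε), Q φ) + ((∫ φ in (0:ℝ)..Real.pi, Q φ) - ∫ φ in (0:ℝ)..(θ + ε), Q φ)) :=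
    (hP.comp (continuous_const.sub continuous_id)).add
      (continuous_const.sub (hP.comp (continuous_const.add continuous_id)))
  have hl := (hc.tendsto 0).mono_left (nhdsWithin_le_nhds (s := Set.Ioi 0))
  have := hl.add ((Af_lim hθ).const_mul c)
  simpa using this

theorem statement_11 (t θ : ℝ) (hθ : θ ∈ Set.Ioo 0 Real.pi) :
    Tendsto
      (fun ε : ℝ =>
        (Real.cos (2 * t * Real.sin θ) - besselJR 0 (2 * t)) / 2 -
          1 / (2 * Real.pi) *
            ∫ φ in Set.Icc 0 Real.pi \ Set.Ioo (θ - ε) (θ + ε),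
              Real.sin (2 * t * Real.sin φ) * Real.sin φ / (Real.cos θ - Real.cos φ))
      (nhdsWithin 0 (Set.Ioi 0))
      (nhds (∑' m : ℕ, (-1) ^ (m + 1) * besselJR (m + 1) (2 * t) *
        Real.cos ((m + 1) * θ))) := by
  obtain ⟨C, hC, hJ⟩ := bes_bound t
  set b : ℕ → ℝ := fun n => (1 - (-1) ^ n) * besselJR n (2 * t) with hb
  have hbb : ∀ n φ, ‖b n * Qf θ n φ‖ ≤ 2 * C * ((4 * |t|) ^ n / (Nat.factorial n : ℝ)) := by
    intro n φ
    rw [Real.norm_eq_abs, hb, abs_mul, abs_mul]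
    have h1 : |(1 - (-1) ^ n : ℝ)| ≤ 2 := by
      rcases neg_one_pow_eq_or ℝ n with h | h <;> rw [h] <;> norm_num
    calc _ ≤ 2 * (C * (|t| ^ n / (Nat.factorial n : ℝ))) * 4 ^ n := by
          gcongr
          · exact hJ n
          · exact Qf_bound θ φ n
      _ = _ := by rw [mul_pow]; ring
  have hsum : Summable (fun n : ℕ => 2 * C * ((4 * |t|) ^ n / (Nat.factorial n : ℝ))) :=
    (Real.summable_pow_div_factorial (4 * |t|)).mul_left _
  set Q : ℝ → ℝ := fun φ => ∑' n, b n * Qf θ n φ with hQdef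
  have hQs : ∀ φ, HasSum (fun n => b n * Qf θ n φ) (Q φ) := fun φ =>
    (Summable.of_norm_bounded hsum (fun n => hbb n φ)).hasSum
  have hQ : Continuous Q :=
    continuous_tsum (fun n => continuous_const.mul (Qf_cont θ n)) hsum hbb
  have hint : HasSum (fun n => ∫ φ in (0:ℝ)..Real.pi, b n * Qf θ n φ) (∫ φ in (0:ℝ)..Real.pi, Q φ) := by
    refine intervalIntegral.hasSum_integral_of_dominated_convergence
      (fun n _ => 2 * C * ((4 * |t|) ^ n / (Nat.factorial n : ℝ))) ?_ ?_ ?_ ?_ ?_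
    · exact fun n => (continuous_const.mul (Qf_cont θ n)).aestronglyMeasurable
    · exact fun n => Eventually.of_forall fun φ _ => hbb n φ
    · exact Eventually.of_forall fun φ _ => hsum
    · exact intervalIntegrable_const
    · exact Eventually.of_forall fun φ _ => hQs φ
  have hint2 : HasSum (fun n : ℕ => b n * (Real.pi * Real.cos (n * θ))) (∫ φ in (0:ℝ)..Real.pi, Q φ) := by
    convert hint using 1
    ext n
    rw [intervalIntegral.integral_const_mul]
    cases n with
    | zero => simp [hb]
    | succ n => rw [Qf_int]
  have hspec : ∀ φ, Q φ * (Real.cos θ - Real.cos φ) =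
      Real.sin (2 * t * Real.sin φ) * Real.sin φ - Real.sin (2 * t * Real.sin θ) * Real.sin θ := by
    intro φ
    refine ((hQs φ).mul_right _).unique ?_
    convert! ((odd_sum t φ).mul_right (Real.sin φ)).sub ((odd_sum t θ).mul_right (Real.sin θ)) using 1
    ext n
    rw [mul_assoc, Qf_spec]
    ring
  have hpv := pv_lim hθ (fun φ => Real.sin (2 * t * Real.sin φ) * Real.sin φ) Q _ hQ hspec
  have hlim := (hpv.const_mul (1 / (2 * Real.pi))).const_sub
    ((Real.cos (2 * t * Real.sin θ) - besselJR 0 (2 * t)) / 2)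
  convert hlim using 2
  have hpi := Real.pi_ne_zero
  have hfin := ((even_sum t θ).div_const 2).sub (hint2.mul_left (1 / (2 * Real.pi)))
  have hfin2 := (hasSum_nat_add_iff' 1).2 hfin
  have key : HasSum (fun m : ℕ => (-1) ^ (m + 1) * besselJR (m + 1) (2 * t) *
        Real.cos ((m + 1) * θ)) ((Real.cos (2 * t * Real.sin θ) - besselJR 0 (2 * t)) / 2 -
      1 / (2 * Real.pi) * ∫ φ in (0:ℝ)..Real.pi, Q φ) := by
    convert! hfin2 using 1
    · ext m
      simp only [hb]
      push_cast
      field_simp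
      ring
    · simp [hb]
      ring
  exact key.tsum_eq
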